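/- (Volterra-type Gronwall inequality) Let f ∈ L¹_loc(ℝ₊; ℝ₊), T > 0, γ₁, γ₂ ∈ [0,1), c₁, c₂ > 0, and suppose f(t) ≤ c₁ t^{-γ₁} + c₂ ∫_0^t (t−s)^{-γ₂} f(s) ds for all t ∈ (0,T]. Then there is a constant c₃ depending only on c₂, T, γ₁, γ₂ such that f(t) ≤ c₃ c₁ t^{-γ₁} for all t ∈ (0,T]. -/

import Mathlib

open MeasureTheory Set

lemma vg_abs (T : ℝ) (κ G U A : ℝ → ENNReal) (hκ : Measurable κ)
    (hG : AEMeasurable G (volume.restrict (Ioc 0 T))) (hU : Measurable U)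
    (hGf : ∫⁻ s in Ioc 0 T, G s ≠ ⊤)
    (h1 : ∀ t ∈ Ioc 0 T, G t ≤ A t + ∫⁻ s in Ioc 0 T, κ (t - s) * G s)
    (h2 : ∀ t ∈ Ioc 0 T, A t + ∫⁻ s in Ioc 0 T, κ (t - s) * U s ≤ U t)
    (hk : ∫⁻ x, κ x ≤ 2⁻¹) : ∀ t ∈ Ioc 0 T, G t ≤ U t := by
  set μ := volume.restrict (Ioc 0 T) with hμ
  set d : ℝ → ENNReal := fun t => G t - U t with hd
  have hdm : AEMeasurable d μ := hG.sub hU.aemeasurable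
  have h3 : ∀ t ∈ Ioc 0 T, d t ≤ ∫⁻ s, κ (t - s) * d s ∂μ := by
    intro t ht
    refine tsub_le_iff_left.2 ((h1 t ht).trans ?_)
    have : ∫⁻ s, κ (t - s) * G s ∂μ ≤
        ∫⁻ s, κ (t - s) * U s ∂μ + ∫⁻ s, κ (t - s) * d s ∂μ := by
      rw [← lintegral_add_left (by fun_prop)]
      refine lintegral_mono fun s => ?_
      simp only [← mul_add]
      gcongr
      exact le_add_tsub
    calc _ ≤ A t + (∫⁻ s, κ (t - s) * U s ∂μ + ∫⁻ s, κ (t - s) * d s ∂μ) := by gcongr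
      _ ≤ _ := by rw [← add_assoc]; gcongr; exact h2 t ht
  have hfin : ∫⁻ t, d t ∂μ ≠ ⊤ :=
    ne_top_of_le_ne_top hGf (lintegral_mono fun s => tsub_le_self)
  have h4 : ∫⁻ t, d t ∂μ ≤ 2⁻¹ * ∫⁻ t, d t ∂μ := by
    have hmk := hdm.ae_eq_mk
    set d' := hdm.mk d
    have hd'm : Measurable d' := hdm.measurable_mk
    calc ∫⁻ t, d t ∂μ ≤ ∫⁻ t, ∫⁻ s, κ (t - s) * d s ∂μ ∂μ := by
          refine lintegral_mono_ae ?_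
          filter_upwards [ae_restrict_mem measurableSet_Ioc] with t ht using h3 t ht
      _ = ∫⁻ t, ∫⁻ s, κ (t - s) * d' s ∂μ ∂μ := by
          refine lintegral_congr fun t => lintegral_congr_ae ?_
          filter_upwards [hmk] with s hs
          rw [hs]
      _ = ∫⁻ s, ∫⁻ t, κ (t - s) * d' s ∂μ ∂μ := by
          apply lintegral_lintegral_swap
          apply Measurable.aemeasurable
          unfold Function.uncurry
          fun_prop
      _ ≤ ∫⁻ s, 2⁻¹ * d' s ∂μ := by
          refine lintegral_mono fun s => ?_
          simp only
          rw [lintegral_mul_const _ (by fun_prop)]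
          gcongr
          calc _ ≤ ∫⁻ t, κ (t - s) := setLIntegral_le_lintegral _ _
            _ = ∫⁻ t, κ t := lintegral_sub_right_eq_self _ s
            _ ≤ _ := hk
      _ = 2⁻¹ * ∫⁻ t, d' t ∂μ := lintegral_const_mul _ hd'm
      _ = _ := by rw [lintegral_congr_ae hmk]
  have h5 : ∫⁻ t, d t ∂μ = 0 := by
    by_contra h0
    have := ENNReal.half_lt_self h0 hfin
    rw [ENNReal.div_eq_inv_mul] at this
    exact absurd h4 (not_le.2 this)
  intro t ht
  have h6 := h3 t ht
  have h7 : ∫⁻ s, κ (t - s) * d s ∂μ = 0 := by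
    rw [lintegral_eq_zero_iff' hdm] at h5
    rw [← lintegral_zero (μ := μ)]
    refine lintegral_congr_ae ?_
    filter_upwards [h5] with s hs
    rw [hs]; simp
  rw [h7] at h6
  exact tsub_eq_zero_iff_le.1 (le_antisymm h6 bot_le)

noncomputable def vgP (γ T : ℝ) : ℝ → ENNReal :=
  (Ioc 0 T).indicator (fun x => ENNReal.ofReal (x ^ (-γ)))

lemma vgP_meas (γ T : ℝ) : Measurable (vgP γ T) := by
  unfold vgP
  exact Measurable.indicator (by fun_prop) measurableSet_Ioc

lemma vgP_int (γ T : ℝ) (hγ : γ < 1) (hT : 0 < T) :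
    ∫⁻ x, vgP γ T x = ENNReal.ofReal (T ^ (1 - γ) / (1 - γ)) := by
  unfold vgP
  rw [lintegral_indicator measurableSet_Ioc]
  rw [← ofReal_integral_eq_lintegral_ofReal]
  · rw [← intervalIntegral.integral_of_le hT.le, integral_rpow (Or.inl (by linarith))]
    rw [Real.zero_rpow (by linarith)]
    congr 1
    ring_nf
  · rw [← IntegrableOn, ← intervalIntegrable_iff_integrableOn_Ioc_of_le hT.le]
    exact intervalIntegral.intervalIntegrable_rpow' (by linarith)
  · filter_upwards [ae_restrict_mem measurableSet_Ioc] with x hx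
    exact Real.rpow_nonneg hx.1.le _

lemma vg_exp (p y : ℝ) (hp : 0 < p) (hp1 : p ≤ 1) (hy : 0 < y) : Real.exp (-y) ≤ y ^ (-p) := by
  rw [Real.rpow_def_of_pos hy, Real.exp_le_exp]
  have := Real.log_le_sub_one_of_pos hy
  rcases le_total 0 (Real.log y) with h | h <;> nlinarith

/-- pointwise splitting -/
lemma vg_split (β γ T t s : ℝ) (hβ : 0 ≤ β) (hγ : 0 ≤ γ) (ht : 0 < t)
    (hs : 0 < s) : vgP β T (t - s) * ENNReal.ofReal (s ^ (-γ)) ≤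
      ENNReal.ofReal ((t/2) ^ (-β)) * vgP γ t s
        + ENNReal.ofReal ((t/2) ^ (-γ)) * vgP β t (t - s) := by
  by_cases h : t - s ∈ Ioc 0 T
  · have h1 : t - s ∈ Ioc 0 t := ⟨h.1, by linarith⟩
    have h2 : s ∈ Ioc 0 t := ⟨hs, by linarith [h.1]⟩
    simp only [vgP, indicator_of_mem h, indicator_of_mem h1, indicator_of_mem h2]
    rcases le_total s (t/2) with h3 | h3
    · refine le_trans ?_ le_self_add
      gcongr ENNReal.ofReal ?_ * _
      exact Real.rpow_le_rpow_of_nonpos (by linarith) (by linarith) (by linarith)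
    · refine le_trans ?_ le_add_self
      rw [mul_comm]
      gcongr ENNReal.ofReal ?_ * _
      exact Real.rpow_le_rpow_of_nonpos (by linarith) (by linarith) (by linarith)
  · simp [vgP, indicator_of_notMem h]

lemma vg_half (t γ : ℝ) (ht : 0 < t) (hγ0 : 0 ≤ γ) (hγ : γ ≤ 1) :
    (t/2) ^ (-γ) ≤ 2 * t ^ (-γ) := by
  rw [div_eq_mul_inv, Real.mul_rpow ht.le (by norm_num), mul_comm, Real.inv_rpow (by norm_num),
    Real.rpow_neg (by norm_num) γ, inv_inv]
  gcongr
  calc (2:ℝ)^γ ≤ 2 ^ (1:ℝ) := Real.rpow_le_rpow_of_exponent_le (by norm_num) hγ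
    _ = 2 := by simp

lemma vg_conv (β γ T t : ℝ) (hβ : 0 ≤ β) (hβ1 : β < 1) (hγ : 0 ≤ γ) (hγ1 : γ < 1) (ht : 0 < t)
    (htT : t ≤ T) :
    ∫⁻ s in Ioc 0 T, vgP β T (t - s) * ENNReal.ofReal (s ^ (-γ)) ≤
      ENNReal.ofReal (T ^ (1 - β) * (2 / (1 - γ) + 2 / (1 - β)) * t ^ (-γ)) := by
  have m1 := vgP_meas γ t
  have m2 := vgP_meas β t
  calc _ ≤ ∫⁻ s in Ioc 0 T, (ENNReal.ofReal ((t/2) ^ (-β)) * vgP γ t s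
        + ENNReal.ofReal ((t/2) ^ (-γ)) * vgP β t (t - s)) := by
        refine lintegral_mono_ae ?_
        filter_upwards [ae_restrict_mem measurableSet_Ioc] with s hs
        exact vg_split β γ T t s hβ hγ ht hs.1
    _ ≤ ∫⁻ s, (ENNReal.ofReal ((t/2) ^ (-β)) * vgP γ t s
        + ENNReal.ofReal ((t/2) ^ (-γ)) * vgP β t (t - s)) := setLIntegral_le_lintegral _ _
    _ = ENNReal.ofReal ((t/2) ^ (-β)) * ENNReal.ofReal (t ^ (1 - γ) / (1 - γ))
        + ENNReal.ofReal ((t/2) ^ (-γ)) * ENNReal.ofReal (t ^ (1 - β) / (1 - β)) := by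
        rw [lintegral_add_left (by fun_prop), lintegral_const_mul _ m1,
          lintegral_const_mul _ (by fun_prop), lintegral_sub_left_eq_self (vgP β t) t,
          vgP_int _ _ hγ1 ht, vgP_int _ _ hβ1 ht]
    _ ≤ _ := by
        have a1 : 0 < 1 - γ := by linarith
        have a2 : 0 < 1 - β := by linarith
        rw [← ENNReal.ofReal_mul (by positivity), ← ENNReal.ofReal_mul (by positivity),
          ← ENNReal.ofReal_add (by positivity) (by positivity)]
        apply ENNReal.ofReal_le_ofReal
        have e1 := vg_half t β ht hβ hβ1.le
        have e2 := vg_half t γ ht hγ hγ1.le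
        have e3 : t ^ (-β) * t ^ (1 - γ) = t ^ (1 - β) * t ^ (-γ) := by
          rw [← Real.rpow_add ht, ← Real.rpow_add ht]; ring_nf
        have e4 : t ^ (1 - β) ≤ T ^ (1 - β) := Real.rpow_le_rpow ht.le htT a2.le
        calc _ ≤ (2 * t ^ (-β)) * (t ^ (1 - γ) / (1 - γ)) +
              (2 * t ^ (-γ)) * (t ^ (1 - β) / (1 - β)) := by gcongr
          _ = 2 / (1 - γ) * (t ^ (-β) * t ^ (1 - γ)) +
              (2 * t ^ (-γ)) * (t ^ (1 - β) / (1 - β)) := by ring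
          _ = t ^ (1 - β) * (2 / (1 - γ) + 2 / (1 - β)) * t ^ (-γ) := by rw [e3]; ring
          _ ≤ _ := by gcongr



/-- Volterra-type Gronwall inequality: if `f ∈ L¹_loc((0,T];ℝ₊)` satisfies
`f(t) ≤ c₁ t^{-γ₁} + c₂ ∫_0^t (t-s)^{-γ₂} f(s) ds` on `(0,T]` with `γ₁, γ₂ ∈ [0,1)`,
then `f(t) ≤ c₃ c₁ t^{-γ₁}` for a constant `c₃` depending only on `c₂, T, γ₁, γ₂`. -/
theorem volterra_gronwall (T γ₁ γ₂ c₂ : ℝ) (hT : 0 < T)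
    (hγ₁0 : 0 ≤ γ₁) (hγ₁1 : γ₁ < 1) (hγ₂0 : 0 ≤ γ₂) (hγ₂1 : γ₂ < 1) (hc₂ : 0 < c₂) :
    ∃ c₃ : ℝ, 0 < c₃ ∧ ∀ (f : ℝ → ℝ) (c₁ : ℝ), 0 < c₁ →
      (∀ t ∈ Ioc (0 : ℝ) T, 0 ≤ f t) →
      IntegrableOn f (Ioc (0 : ℝ) T) →
      (∀ t ∈ Ioc (0 : ℝ) T,
        f t ≤ c₁ * t ^ (-γ₁) + c₂ * ∫ s in Ioo (0 : ℝ) t, (t - s) ^ (-γ₂) * f s) →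
      ∀ t ∈ Ioc (0 : ℝ) T, f t ≤ c₃ * c₁ * t ^ (-γ₁) := by
  set β := (1 + γ₂) / 2 with hβ
  set p := (1 - γ₂) / 2 with hp
  have hp0 : 0 < p := by rw [hp]; linarith
  have hp1 : p ≤ 1 := by rw [hp]; linarith
  have hβ0 : 0 ≤ β := by rw [hβ]; linarith
  have hβ1 : β < 1 := by rw [hβ]; linarith
  have a1 : 0 < 1 - γ₁ := by linarith
  have a2 : 0 < 1 - β := by linarith
  set M := T ^ (1 - β) * (2 / (1 - γ₁) + 2 / (1 - β)) with hM
  have hM0 : 0 < M := by positivity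
  set l := (2 * c₂ * M) ^ (1 / p) with hl
  have hl0 : 0 < l := by positivity
  have hlp : c₂ * l ^ (-p) = 1 / (2 * M) := by
    rw [hl, ← Real.rpow_mul (by positivity)]
    have : 1 / p * -p = -1 := by field_simp
    rw [this, Real.rpow_neg_one]
    field_simp
  refine ⟨2 * Real.exp (l * T), by positivity, ?_⟩
  intro f c₁ hc₁ hf0 hfi hf
  have key : ∀ x, 0 < x → c₂ * (Real.exp (-(l * x)) * x ^ (-γ₂)) ≤ 1 / (2 * M) * x ^ (-β) := by
    intro x hx
    have := vg_exp p (l * x) hp0 hp1 (by positivity)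
    rw [Real.mul_rpow hl0.le hx.le] at this
    calc _ ≤ c₂ * (l ^ (-p) * x ^ (-p) * x ^ (-γ₂)) := by gcongr
      _ = c₂ * l ^ (-p) * (x ^ (-p) * x ^ (-γ₂)) := by ring
      _ = _ := by
        rw [hlp, ← Real.rpow_add hx]
        congr 2
        rw [hp, hβ]; ring
  have hPm := vgP_meas β T
  have main := vg_abs T (fun x => ENNReal.ofReal (1 / (2 * M)) * vgP β T x)
    (fun t => ENNReal.ofReal (Real.exp (-(l * t)) * f t))
    (fun t => ENNReal.ofReal (2 * c₁) * ENNReal.ofReal (t ^ (-γ₁)))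
    (fun t => ENNReal.ofReal (c₁ * t ^ (-γ₁))) (by fun_prop)
    (by
      have := hfi.aestronglyMeasurable.aemeasurable
      fun_prop) (by fun_prop)
    (by
      refine ne_top_of_le_ne_top (b := ∫⁻ s in Ioc 0 T, ENNReal.ofReal (f s)) ?_ ?_
      · exact hfi.lintegral_lt_top.ne
      · refine lintegral_mono_ae ?_
        filter_upwards [ae_restrict_mem measurableSet_Ioc] with s hs
        apply ENNReal.ofReal_le_ofReal
        refine mul_le_of_le_one_left (hf0 s hs) ?_
        rw [Real.exp_le_one_iff]
        have := hs.1
        have : 0 < l * s := by positivity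
        linarith)
    (by
      intro t ht
      have ht0 : 0 < t := ht.1
      have hexp : Real.exp (-(l * t)) ≤ 1 := by
        rw [Real.exp_le_one_iff]
        have : 0 < l * t := by positivity
        linarith
      have b2 : Real.exp (-(l * t)) * f t ≤ c₁ * t ^ (-γ₁) +
          ∫ s in Ioo (0 : ℝ) t, Real.exp (-(l * t)) * c₂ * ((t - s) ^ (-γ₂) * f s) := by
        rw [integral_const_mul]
        calc _ ≤ Real.exp (-(l * t)) * (c₁ * t ^ (-γ₁) +
              c₂ * ∫ s in Ioo (0 : ℝ) t, (t - s) ^ (-γ₂) * f s) := by gcongr; exact hf t ht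
          _ = Real.exp (-(l * t)) * (c₁ * t ^ (-γ₁)) + Real.exp (-(l * t)) *
              c₂ * ∫ s in Ioo (0 : ℝ) t, (t - s) ^ (-γ₂) * f s := by ring
          _ ≤ _ := by
            refine add_le_add ?_ le_rfl
            exact mul_le_of_le_one_left (by positivity) hexp
      have hss : Ioo 0 t ⊆ Ioc 0 T := fun s hs => ⟨hs.1, hs.2.le.trans ht.2⟩
      refine (ENNReal.ofReal_le_ofReal b2).trans (ENNReal.ofReal_add_le.trans ?_)
      gcongr
      calc _ ≤ ∫⁻ s in Ioo (0 : ℝ) t, ENNReal.ofReal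
              (Real.exp (-(l * t)) * c₂ * ((t - s) ^ (-γ₂) * f s)) := by
            by_cases hI : IntegrableOn (fun s => Real.exp (-(l * t)) * c₂ * ((t - s) ^ (-γ₂) * f s)) (Ioo 0 t)
            · rw [ofReal_integral_eq_lintegral_ofReal hI]
              filter_upwards [ae_restrict_mem measurableSet_Ioo] with s hs
              have := hf0 s (hss hs)
              have : 0 < t - s := sub_pos.2 hs.2
              simp only [Pi.zero_apply]
              positivity
            · rw [integral_undef hI]; simp
        _ ≤ ∫⁻ s in Ioo (0 : ℝ) t, ENNReal.ofReal (1 / (2 * M)) * vgP β T (t - s) *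
              ENNReal.ofReal (Real.exp (-(l * s)) * f s) := by
            refine lintegral_mono_ae ?_
            filter_upwards [ae_restrict_mem measurableSet_Ioo] with s hs
            have h0 := hf0 s (hss hs)
            have h1 : 0 < t - s := sub_pos.2 hs.2
            have h2 : t - s ∈ Ioc 0 T := ⟨h1, by linarith [hs.1, ht.2]⟩
            simp only [vgP, indicator_of_mem h2]
            rw [← ENNReal.ofReal_mul (by positivity), ← ENNReal.ofReal_mul (by positivity)]
            apply ENNReal.ofReal_le_ofReal
            have : Real.exp (-(l * t)) = Real.exp (-(l * (t - s))) * Real.exp (-(l * s)) := by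
              rw [← Real.exp_add]; ring_nf
            rw [this]
            calc _ = c₂ * (Real.exp (-(l * (t - s))) * (t - s) ^ (-γ₂)) *
                  (Real.exp (-(l * s)) * f s) := by ring
              _ ≤ _ := by
                exact mul_le_mul_of_nonneg_right (key _ h1) (by positivity)
        _ ≤ _ := lintegral_mono_set hss)
    (by
      intro t ht
      have ht0 : 0 < t := ht.1
      have hc := vg_conv β γ₁ T t hβ0 hβ1 hγ₁0 hγ₁1 ht.1 ht.2
      have : ∫⁻ s in Ioc 0 T, ENNReal.ofReal (1 / (2 * M)) * vgP β T (t - s) *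
          (ENNReal.ofReal (2 * c₁) * ENNReal.ofReal (s ^ (-γ₁))) =
          (ENNReal.ofReal (1 / (2 * M)) * ENNReal.ofReal (2 * c₁)) *
          ∫⁻ s in Ioc 0 T, vgP β T (t - s) * ENNReal.ofReal (s ^ (-γ₁)) := by
        rw [← lintegral_const_mul _ (by fun_prop)]
        refine lintegral_congr fun s => ?_
        ring
      rw [this]
      calc _ ≤ ENNReal.ofReal (c₁ * t ^ (-γ₁)) +
            (ENNReal.ofReal (1 / (2 * M)) * ENNReal.ofReal (2 * c₁)) *
            ENNReal.ofReal (M * t ^ (-γ₁)) := by gcongr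
        _ = _ := by
          rw [← ENNReal.ofReal_mul (by positivity), ← ENNReal.ofReal_mul (by positivity),
            ← ENNReal.ofReal_mul (by positivity), ← ENNReal.ofReal_add (by positivity) (by positivity)]
          congr 1
          field_simp
          ring)
    (by
      rw [lintegral_const_mul _ hPm, vgP_int _ _ hβ1 hT, ← ENNReal.ofReal_mul (by positivity)]
      have : (2:ENNReal)⁻¹ = ENNReal.ofReal (1/2) := by
        rw [one_div, ENNReal.ofReal_inv_of_pos (by norm_num)]; simp
      rw [this]
      apply ENNReal.ofReal_le_ofReal
      have h1 : T ^ (1 - β) / (1 - β) ≤ M := by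
        have h2 : 0 < T ^ (1 - β) * (2 / (1 - γ₁)) := by positivity
        have h3 : 0 < T ^ (1 - β) / (1 - β) := by positivity
        have h4 : M = T ^ (1 - β) * (2 / (1 - γ₁)) + 2 * (T ^ (1 - β) / (1 - β)) := by
          rw [hM]; ring
        linarith
      calc _ ≤ 1 / (2 * M) * M := by gcongr
        _ = 1 / 2 := by field_simp)
  intro t ht
  have ht0 : 0 < t := ht.1
  have h := main t ht
  rw [← ENNReal.ofReal_mul (by positivity), ENNReal.ofReal_le_ofReal_iff (by positivity)] at h
  have h1 : f t = Real.exp (l * t) * (Real.exp (-(l * t)) * f t) := by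
    rw [← mul_assoc, ← Real.exp_add]; simp
  rw [h1]
  calc _ ≤ Real.exp (l * T) * (2 * c₁ * t ^ (-γ₁)) := by
        gcongr
        · exact mul_nonneg (Real.exp_pos _).le (hf0 t ht)
        · exact ht.2
    _ = _ := by ring
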